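/- The set of S_n-invariant elements of the splitting algebra A_f equals the image of algebraMap A A_f if and only if every a ∈ A satisfying 2·a = 0 and (algebraMap A A_f a)·D_f = 0 equals 0. -/

import Mathlib

open MvPolynomial

noncomputable section

/-- The ideal defining the splitting algebra of `f = Xⁿ + a₁Xⁿ⁻¹ + ⋯ + aₙ`. -/
def splittingIdeal (A : Type*) [CommRing A] (n : ℕ) (a : Fin n → A) :
    Ideal (MvPolynomial (Fin n) A) :=
  Ideal.span (Set.range fun k : Fin n =>
    esymm (Fin n) A (k.1 + 1) - C ((-1 : A) ^ (k.1 + 1) * a k))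

/-- The splitting algebra `A_f`. -/
abbrev SplittingAlg (A : Type*) [CommRing A] (n : ℕ) (a : Fin n → A) : Type _ :=
  MvPolynomial (Fin n) A ⧸ splittingIdeal A n a

/-- The quotient map `π`. -/
def splittingMk (A : Type*) [CommRing A] (n : ℕ) (a : Fin n → A) :
    MvPolynomial (Fin n) A →ₐ[A] SplittingAlg A n a :=
  Ideal.Quotient.mkₐ A (splittingIdeal A n a)

/-- The universal roots `τᵢ`. -/
def tau (A : Type*) [CommRing A] (n : ℕ) (a : Fin n → A) (i : Fin n) :
    SplittingAlg A n a :=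
  splittingMk A n a (X i)

theorem rename_mem_splittingIdeal (A : Type*) [CommRing A] (n : ℕ) (a : Fin n → A)
    (σ : Equiv.Perm (Fin n)) {p : MvPolynomial (Fin n) A}
    (hp : p ∈ splittingIdeal A n a) :
    rename (σ : Fin n → Fin n) p ∈ splittingIdeal A n a := by
  have h : (splittingIdeal A n a).map ((rename (σ : Fin n → Fin n)).toRingHom :
      MvPolynomial (Fin n) A →+* MvPolynomial (Fin n) A) ≤ splittingIdeal A n a := by
    rw [splittingIdeal, Ideal.map_span]
    refine Ideal.span_le.2 ?_
    rintro _ ⟨_, ⟨k, rfl⟩, rfl⟩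
    have hren : (rename (σ : Fin n → Fin n))
        (esymm (Fin n) A (k.1 + 1) - C ((-1 : A) ^ (k.1 + 1) * a k))
        = esymm (Fin n) A (k.1 + 1) - C ((-1 : A) ^ (k.1 + 1) * a k) := by
      rw [map_sub, esymm_isSymmetric (Fin n) A (k.1 + 1) σ, rename_C]
    show (rename (σ : Fin n → Fin n))
        (esymm (Fin n) A (k.1 + 1) - C ((-1 : A) ^ (k.1 + 1) * a k)) ∈ _
    rw [hren]
    exact Ideal.subset_span ⟨k, rfl⟩
  exact h (Ideal.mem_map_of_mem _ hp)

/-- The action of a permutation `σ` on the splitting algebra, as an `A`-algebra map. -/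
def permHom (A : Type*) [CommRing A] (n : ℕ) (a : Fin n → A) (σ : Equiv.Perm (Fin n)) :
    SplittingAlg A n a →ₐ[A] SplittingAlg A n a :=
  Ideal.Quotient.liftₐ (splittingIdeal A n a)
    ((splittingMk A n a).comp (rename (σ : Fin n → Fin n)))
    (fun p hp => by
      have h := rename_mem_splittingIdeal A n a σ hp
      show Ideal.Quotient.mkₐ A (splittingIdeal A n a) _ = 0
      rw [Ideal.Quotient.mkₐ_eq_mk]
      exact (Ideal.Quotient.eq_zero_iff_mem).2 h)

/-- The trivial `G`-invariants of the splitting algebra. -/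
def trivialInv (A : Type*) [CommRing A] (n : ℕ) (a : Fin n → A)
    (G : Subgroup (Equiv.Perm (Fin n))) : Set (SplittingAlg A n a) :=
  splittingMk A n a '' {p | ∀ σ ∈ G, rename (σ : Fin n → Fin n) p = p}

/-- The element `D_f = ∏_{i<j} (τᵢ + τⱼ)`. -/
def Df (A : Type*) [CommRing A] (n : ℕ) (a : Fin n → A) : SplittingAlg A n a :=
  ∏ p ∈ Finset.univ.filter (fun p : Fin n × Fin n => p.1 < p.2),
    (tau A n a p.1 + tau A n a p.2)

end

universe u v

/-- The exponents `s` with `s i < n - i`, which index the monomial basis of the splitting algebra. -/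
abbrev Staircase (n : ℕ) : Type := {s : Fin n →₀ ℕ // ∀ i, s i + i.1 < n}

theorem Staircase.finite (n : ℕ) : Finite (Staircase n) := by
  refine Finite.of_injective
    (fun (s : Staircase n) (i : Fin n) => (⟨s.1 i, by have := s.2 i; omega⟩ : Fin n)) ?_
  intro s t h
  ext i
  have := congrFun h i
  simpa using this

noncomputable instance (n : ℕ) : Fintype (Staircase n) :=
  haveI := Staircase.finite n
  Fintype.ofFinite _

/-- The zero exponent. -/
def Staircase.zero (n : ℕ) : Staircase n := ⟨0, fun i => by simp⟩

/-- Splitting off the first exponent. -/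
noncomputable def Staircase.consEquiv (n : ℕ) :
    Fin (n + 1) × Staircase n ≃ Staircase (n + 1) where
  toFun p := ⟨Finsupp.cons p.1.1 p.2.1, fun i => by
    refine Fin.cases ?_ (fun j => ?_) i
    · have := p.1.2
      simp only [Finsupp.cons_zero, Fin.val_zero]
      omega
    · have := p.2.2 j
      simp only [Finsupp.cons_succ, Fin.val_succ]
      omega⟩
  invFun s := (⟨s.1 0, by simpa using s.2 0⟩, ⟨Finsupp.tail s.1, fun i => by
    have := s.2 i.succ
    simp only [Finsupp.tail_apply, Fin.val_succ] at this ⊢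
    omega⟩)
  left_inv p := by
    ext <;> simp
  right_inv s := by
    ext i
    refine Fin.cases ?_ (fun j => ?_) i <;> simp

theorem exists_basis_of_monic (n : ℕ) :
    ∀ (A : Type u) [CommRing A] [Nontrivial A] (f : Polynomial A), f.Monic → f.natDegree = n →
    ∃ (B : Type u) (_ : CommRing B) (_ : Algebra A B) (t : Fin n → B)
      (b : Module.Basis (Staircase n) A B),
      f.map (algebraMap A B) = ∏ i, (Polynomial.X - Polynomial.C (t i)) ∧
      (∀ s, b s = ∏ i, t i ^ s.1 i) ∧
      ∀ (S : Type u) [CommRing S] (φ : A →+* S) (t' : Fin n → S),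
        f.map φ = ∏ i, (Polynomial.X - Polynomial.C (t' i)) →
        ∃ ψ : B →+* S, ψ.comp (algebraMap A B) = φ ∧ ∀ i, ψ (t i) = t' i := by
  induction n with
  | zero =>
    intro A _ _ f hf hn
    have : Unique (Staircase 0) :=
      ⟨⟨Staircase.zero 0⟩, fun s => by ext i; exact i.elim0⟩
    have hf1 : f = 1 := hf.natDegree_eq_zero.1 hn
    refine ⟨A, inferInstance, Algebra.id A, Fin.elim0, Module.Basis.singleton _ A, ?_, ?_, ?_⟩
    · simp [hf1]
    · simp
    · intro S _ φ t' _
      exact ⟨φ, by ext; simp, fun i => i.elim0⟩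
  | succ n ih =>
    intro A _ _ f hf hn
    have hdim : (AdjoinRoot.powerBasis' hf).dim = n + 1 := by simp [hn]
    have hnt : Nontrivial (AdjoinRoot f) :=
      ⟨_, 0, (AdjoinRoot.powerBasis' hf).basis.ne_zero ⟨0, by omega⟩⟩
    set x := AdjoinRoot.root f with hx
    set g := f.map (AdjoinRoot.of f) /ₘ (Polynomial.X - Polynomial.C x) with hg
    have hfg : (Polynomial.X - Polynomial.C x) * g = f.map (AdjoinRoot.of f) := by
      rw [hg, Polynomial.mul_divByMonic_eq_iff_isRoot, Polynomial.IsRoot, Polynomial.eval_map]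
      exact AdjoinRoot.eval₂_root f
    have hgm : g.Monic := by
      have := hf.map (AdjoinRoot.of f)
      rw [← hfg] at this
      exact (Polynomial.monic_X_sub_C x).of_mul_monic_left this
    have hgn : g.natDegree = n := by
      rw [hg, Polynomial.natDegree_divByMonic _ (Polynomial.monic_X_sub_C x),
        hf.natDegree_map, hn, Polynomial.natDegree_X_sub_C]
      rfl
    obtain ⟨B, _, _, t, b, hsplit, hb, huniv⟩ := ih (AdjoinRoot f) g hgm hgn
    let _ : Algebra A B := ((algebraMap (AdjoinRoot f) B).comp (AdjoinRoot.of f)).toAlgebra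
    have : IsScalarTower A (AdjoinRoot f) B := IsScalarTower.of_algebraMap_eq' rfl
    refine ⟨B, inferInstance, inferInstance, Fin.cons (algebraMap _ B x) t,
      (((AdjoinRoot.powerBasis' hf).basis.reindex (finCongr hdim)).smulTower b).reindex
        (Staircase.consEquiv n), ?_, ?_, ?_⟩
    · rw [show algebraMap A B = (algebraMap (AdjoinRoot f) B).comp (AdjoinRoot.of f) from rfl,
        ← Polynomial.map_map, ← hfg, Polynomial.map_mul, hsplit, Fin.prod_univ_succ]
      simp
    · intro s
      obtain ⟨⟨i, s⟩, rfl⟩ := (Staircase.consEquiv n).surjective s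
      rw [Module.Basis.reindex_apply, Equiv.symm_apply_apply, Module.Basis.smulTower_apply, hb,
        Fin.prod_univ_succ]
      simp [Staircase.consEquiv, Algebra.smul_def, hx]
    · intro S _ φ t' ht'
      have hroot : f.eval₂ φ (t' 0) = 0 := by
        rw [← Polynomial.eval_map, ht', Polynomial.eval_prod]
        exact Finset.prod_eq_zero (Finset.mem_univ 0) (by simp)
      obtain ⟨ψ, hψ, hψt⟩ := huniv S (AdjoinRoot.lift φ (t' 0) hroot) (fun i => t' i.succ) (by
        have h := congrArg (Polynomial.map (AdjoinRoot.lift φ (t' 0) hroot)) hfg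
        rw [Polynomial.map_map, AdjoinRoot.lift_comp_of, ht', Fin.prod_univ_succ,
          Polynomial.map_mul] at h
        simp only [Polynomial.map_sub, Polynomial.map_X, Polynomial.map_C, hx,
          AdjoinRoot.lift_root] at h
        exact (Polynomial.monic_X_sub_C (t' 0)).isRegular.left h)
      refine ⟨ψ, ?_, ?_⟩
      · rw [show algebraMap A B = (algebraMap (AdjoinRoot f) B).comp (AdjoinRoot.of f) from rfl,
          ← RingHom.comp_assoc, hψ, AdjoinRoot.lift_comp_of]
      · intro i
        refine Fin.cases ?_ (fun j => ?_) i
        · have := congrArg (fun h : AdjoinRoot f →+* S => h x) hψ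
          simpa [hx] using this
        · simpa using hψt j

@[simp]
theorem permHom_tau (A : Type*) [CommRing A] (n : ℕ) (a : Fin n → A) (σ : Equiv.Perm (Fin n))
    (i : Fin n) : permHom A n a σ (tau A n a i) = tau A n a (σ i) := by
  show splittingMk A n a (rename σ (X i)) = _
  rw [rename_X]
  rfl

theorem permHom_mk (A : Type*) [CommRing A] (n : ℕ) (a : Fin n → A) (σ : Equiv.Perm (Fin n))
    (p : MvPolynomial (Fin n) A) :
    permHom A n a σ (splittingMk A n a p) = splittingMk A n a (rename σ p) := rfl

theorem splittingMk_eq_zero_iff (A : Type*) [CommRing A] (n : ℕ) (a : Fin n → A)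
    (p : MvPolynomial (Fin n) A) : splittingMk A n a p = 0 ↔ p ∈ splittingIdeal A n a :=
  Ideal.Quotient.eq_zero_iff_mem

theorem splittingMk_esymm (A : Type*) [CommRing A] (n : ℕ) (a : Fin n → A) (k : Fin n) :
    splittingMk A n a (esymm (Fin n) A (k.1 + 1)) =
      algebraMap A (SplittingAlg A n a) ((-1 : A) ^ (k.1 + 1) * a k) := by
  have h := (splittingMk_eq_zero_iff A n a _).2 (Ideal.subset_span ⟨k, rfl⟩)
  rw [map_sub, sub_eq_zero] at h
  exact h

/-- The ring homomorphism out of the splitting algebra determined by a system of roots. -/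
noncomputable def splittingLift {A S : Type*} [CommRing A] [CommRing S] (n : ℕ) (a : Fin n → A)
    (φ : A →+* S) (t : Fin n → S)
    (h : ∀ k : Fin n, ((Finset.univ.val.map t).esymm (k.1 + 1)) = φ ((-1 : A) ^ (k.1 + 1) * a k)) :
    SplittingAlg A n a →+* S :=
  Ideal.Quotient.lift (splittingIdeal A n a) (eval₂Hom φ t) (fun p hp => by
    have : splittingIdeal A n a ≤ RingHom.ker (eval₂Hom φ t) := by
      refine Ideal.span_le.2 ?_
      rintro _ ⟨k, rfl⟩
      let _ := φ.toAlgebra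
      have := aeval_esymm_eq_multiset_esymm (Fin n) A (k.1 + 1) t
      rw [SetLike.mem_coe, RingHom.mem_ker, map_sub, sub_eq_zero, eval₂Hom_C, ← h k, ← this]
      rfl
    exact this hp)

theorem splittingLift_tau {A S : Type*} [CommRing A] [CommRing S] (n : ℕ) (a : Fin n → A)
    (φ : A →+* S) (t : Fin n → S) (h) (i : Fin n) :
    splittingLift n a φ t h (tau A n a i) = t i := by
  show eval₂Hom φ t (X i) = t i
  simp

theorem splittingLift_algebraMap {A S : Type*} [CommRing A] [CommRing S] (n : ℕ) (a : Fin n → A)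
    (φ : A →+* S) (t : Fin n → S) (h) (c : A) :
    splittingLift n a φ t h (algebraMap A _ c) = φ c := by
  show eval₂Hom φ t (C c) = φ c
  simp

theorem splittingAlg_hom_ext {A S : Type*} [CommRing A] [CommRing S] {n : ℕ} {a : Fin n → A}
    {f g : SplittingAlg A n a →+* S}
    (hC : ∀ c, f (algebraMap A _ c) = g (algebraMap A _ c))
    (hX : ∀ i, f (tau A n a i) = g (tau A n a i)) : f = g := by
  refine Ideal.Quotient.ringHom_ext (MvPolynomial.ringHom_ext ?_ ?_)
  · exact hC
  · exact hX

/-- The polynomial `Xⁿ + a₁Xⁿ⁻¹ + ⋯ + aₙ`. -/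
noncomputable def splittingPoly {A : Type*} [CommRing A] {n : ℕ} (a : Fin n → A) :
    Polynomial A :=
  Polynomial.X ^ n + ∑ k : Fin n, Polynomial.C (a k) * Polynomial.X ^ (n - (k.1 + 1))

theorem splittingPoly_degree_lt {A : Type*} [CommRing A] [Nontrivial A] {n : ℕ} (a : Fin n → A) :
    (∑ k : Fin n, Polynomial.C (a k) * Polynomial.X ^ (n - (k.1 + 1))).degree <
      ((Polynomial.X : Polynomial A) ^ n).degree := by
  rw [Polynomial.degree_X_pow]
  refine (Polynomial.degree_sum_le _ _).trans_lt ((Finset.sup_lt_iff (WithBot.bot_lt_coe n)).2 ?_)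
  intro k _
  refine (Polynomial.degree_C_mul_X_pow_le _ _).trans_lt ?_
  have := k.2
  exact WithBot.coe_lt_coe.2 (show n - (k.1 + 1) < n by omega)

theorem splittingPoly_monic {A : Type*} [CommRing A] [Nontrivial A] {n : ℕ} (a : Fin n → A) :
    (splittingPoly a).Monic :=
  (Polynomial.monic_X_pow n).add_of_left (splittingPoly_degree_lt a)

theorem splittingPoly_natDegree {A : Type*} [CommRing A] [Nontrivial A] {n : ℕ} (a : Fin n → A) :
    (splittingPoly a).natDegree = n := by
  rw [splittingPoly, Polynomial.natDegree_add_eq_left_of_degree_lt (splittingPoly_degree_lt a),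
    Polynomial.natDegree_X_pow]

theorem splittingPoly_coeff {A : Type*} [CommRing A] {n : ℕ} (a : Fin n → A) (k : Fin n) :
    (splittingPoly a).coeff (n - (k.1 + 1)) = a k := by
  rw [splittingPoly, Polynomial.coeff_add, Polynomial.coeff_X_pow, Polynomial.finsetSum_coeff,
    if_neg (by omega), zero_add, Finset.sum_eq_single k]
  · simp
  · intro j _ hj
    rw [Polynomial.coeff_C_mul_X_pow, if_neg]
    intro h
    apply hj
    ext
    omega
  · simp

theorem splittingPoly_map_eq_prod_iff {A S : Type*} [CommRing A] [CommRing S] [Nontrivial A]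
    {n : ℕ} (a : Fin n → A) (φ : A →+* S) (t : Fin n → S) :
    (splittingPoly a).map φ = ∏ i, (Polynomial.X - Polynomial.C (t i)) ↔
      ∀ k : Fin n, ((Finset.univ.val.map t).esymm (k.1 + 1)) =
        φ ((-1 : A) ^ (k.1 + 1) * a k) := by
  have key : ∀ k : Fin n, (∏ i, (Polynomial.X - Polynomial.C (t i))).coeff (n - (k.1 + 1)) =
      (-1) ^ (k.1 + 1) * (Finset.univ.val.map t).esymm (k.1 + 1) := by
    intro k
    have h := Multiset.prod_X_sub_C_coeff (Finset.univ.val.map t) (k := n - (k.1 + 1))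
      (by simp)
    have hk : n - (n - (k.1 + 1)) = k.1 + 1 := by omega
    simp only [Multiset.map_map, Multiset.card_map, Finset.card_val, Finset.card_univ,
      Fintype.card_fin, hk] at h
    rw [← h]
    rfl
  have hsq : ∀ m : ℕ, ((-1 : S) ^ m) * (-1) ^ m = 1 := fun m => by
    rw [← mul_pow]; simp
  constructor
  · intro h k
    have h1 := congrArg (fun p => Polynomial.coeff p (n - (k.1 + 1))) h
    simp only [key, Polynomial.coeff_map, splittingPoly_coeff] at h1
    rw [map_mul, h1, ← mul_assoc]
    simp [hsq]
  · intro h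
    rcases subsingleton_or_nontrivial S with hS | hS
    · exact Subsingleton.elim _ _
    have hm1 := (splittingPoly_monic a).map φ
    have hm2 : (∏ i, (Polynomial.X - Polynomial.C (t i))).Monic :=
      Polynomial.monic_prod_of_monic _ _ fun i _ => Polynomial.monic_X_sub_C _
    have hd1 : ((splittingPoly a).map φ).natDegree = n := by
      rw [(splittingPoly_monic a).natDegree_map, splittingPoly_natDegree]
    have hd2 : (∏ i, (Polynomial.X - Polynomial.C (t i))).natDegree = n := by
      simp [Polynomial.natDegree_prod_of_monic _ _ fun i _ => Polynomial.monic_X_sub_C (t i)]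
    ext m
    rcases lt_trichotomy m n with hmn | rfl | hmn
    · obtain ⟨k, rfl⟩ : ∃ k : Fin n, m = n - (k.1 + 1) :=
        ⟨⟨n - 1 - m, by omega⟩, by simp only; omega⟩
      rw [key, h, Polynomial.coeff_map, splittingPoly_coeff, map_mul, ← mul_assoc]
      simp [hsq]
    · have h1 := hm1.coeff_natDegree
      have h2 := hm2.coeff_natDegree
      rw [hd1] at h1
      rw [hd2] at h2
      rw [h1, h2]
    · rw [Polynomial.coeff_eq_zero_of_natDegree_lt (by omega),
        Polynomial.coeff_eq_zero_of_natDegree_lt (by omega)]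

theorem esymm_tau (A : Type*) [CommRing A] (n : ℕ) (a : Fin n → A) (k : Fin n) :
    (Finset.univ.val.map (tau A n a)).esymm (k.1 + 1) =
      algebraMap A (SplittingAlg A n a) ((-1 : A) ^ (k.1 + 1) * a k) := by
  rw [← splittingMk_esymm, ← aeval_esymm_eq_multiset_esymm (Fin n) A]
  congr 1
  ext i
  simp [tau]

theorem exists_splittingBasis (A : Type u) [CommRing A] [Nontrivial A] (n : ℕ) (a : Fin n → A) :
    ∃ b : Module.Basis (Staircase n) A (SplittingAlg A n a),
      ∀ s, b s = ∏ i, tau A n a i ^ s.1 i := by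
  obtain ⟨B, _, _, t, b, hsplit, hb, huniv⟩ := exists_basis_of_monic n A (splittingPoly a)
    (splittingPoly_monic a) (splittingPoly_natDegree a)
  obtain ⟨ψ, hψ, hψt⟩ := huniv (SplittingAlg A n a) (algebraMap A _) (tau A n a)
    ((splittingPoly_map_eq_prod_iff a _ _).2 (esymm_tau A n a))
  have ht := (splittingPoly_map_eq_prod_iff a _ _).1 hsplit
  let g := splittingLift n a (algebraMap A B) t ht
  have hψA : ∀ c, ψ (algebraMap A B c) = algebraMap A _ c := fun c =>
    congrArg (fun h : A →+* _ => h c) hψ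
  let ψ' : B →ₐ[A] SplittingAlg A n a := { ψ with commutes' := hψA }
  let g' : SplittingAlg A n a →ₐ[A] B :=
    { g with commutes' := splittingLift_algebraMap n a _ t ht }
  have h1 : ψ'.comp g' = AlgHom.id A _ := by
    have : ψ.comp g = RingHom.id _ := splittingAlg_hom_ext
      (fun c => by
        rw [RingHom.comp_apply, splittingLift_algebraMap, hψA]
        rfl)
      (fun i => by
        rw [RingHom.comp_apply, splittingLift_tau, hψt]
        rfl)
    exact AlgHom.ext fun x => congrArg (fun h : SplittingAlg A n a →+* _ => h x) this
  have h2 : g'.comp ψ' = AlgHom.id A _ := by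
    refine AlgHom.toLinearMap_injective (b.ext fun s => ?_)
    show g (ψ (b s)) = b s
    simp only [hb, map_prod, map_pow, hψt, g, splittingLift_tau]
  refine ⟨b.map (AlgEquiv.ofAlgHom ψ' g' h1 h2).toLinearEquiv, fun s => ?_⟩
  rw [Module.Basis.map_apply]
  show ψ (b s) = _
  simp only [hb, map_prod, map_pow, hψt]

/-- The monomial basis of the splitting algebra. -/
noncomputable def splittingBasis (A : Type u) [CommRing A] [Nontrivial A] (n : ℕ)
    (a : Fin n → A) : Module.Basis (Staircase n) A (SplittingAlg A n a) :=
  (exists_splittingBasis A n a).choose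

theorem splittingBasis_apply (A : Type u) [CommRing A] [Nontrivial A] (n : ℕ) (a : Fin n → A)
    (s : Staircase n) : splittingBasis A n a s = ∏ i, tau A n a i ^ s.1 i :=
  (exists_splittingBasis A n a).choose_spec s

theorem splittingBasis_zero (A : Type u) [CommRing A] [Nontrivial A] (n : ℕ) (a : Fin n → A) :
    splittingBasis A n a (Staircase.zero n) = 1 := by
  simp [splittingBasis_apply, Staircase.zero]

theorem algebraMap_injective_splittingAlg (A : Type u) [CommRing A] [Nontrivial A] (n : ℕ)
    (a : Fin n → A) : Function.Injective (algebraMap A (SplittingAlg A n a)) := by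
  intro x y h
  have h' : x • splittingBasis A n a (Staircase.zero n) =
      y • splittingBasis A n a (Staircase.zero n) := by
    rw [splittingBasis_zero, ← Algebra.algebraMap_eq_smul_one, h, Algebra.algebraMap_eq_smul_one]
  have := congrArg (fun z => (splittingBasis A n a).repr z (Staircase.zero n)) h'
  simpa using this

/-- The shear `X i ↦ X i + X j` for `i ≠ j`. -/
noncomputable def shearEquiv {σ : Type*} [DecidableEq σ] (A : Type*) [CommRing A] {i j : σ}
    (h : i ≠ j) : MvPolynomial σ A ≃ₐ[A] MvPolynomial σ A :=
  AlgEquiv.ofAlgHom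
    (aeval (fun k => if k = i then X i + X j else X k))
    (aeval (fun k => if k = i then X i - X j else X k))
    (by
      ext k
      by_cases hk : k = i <;> simp [hk, h.symm])
    (by
      ext k
      by_cases hk : k = i <;> simp [hk, h.symm])

theorem shearEquiv_sub {σ : Type*} [DecidableEq σ] (A : Type*) [CommRing A] {i j : σ}
    (h : i ≠ j) : shearEquiv A h (X i - X j) = X i := by
  simp [shearEquiv, h.symm]

theorem isRegular_X_sub_X {σ : Type*} [DecidableEq σ] (A : Type*) [CommRing A] {i j : σ}
    (h : i ≠ j) : IsLeftRegular (X i - X j : MvPolynomial σ A) := by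
  rw [isLeftRegular_iff_right_eq_zero_of_mul]
  intro p hp
  have h1 := congrArg (shearEquiv A h) hp
  rw [map_mul, shearEquiv_sub, map_zero] at h1
  refine (shearEquiv A h).injective ?_
  rw [map_zero]
  ext s
  have := congrArg (coeff (Finsupp.single i 1 + s)) h1
  rwa [coeff_X_mul] at this

theorem prime_X_sub_X {σ : Type*} [DecidableEq σ] (A : Type*) [CommRing A] [IsDomain A] {i j : σ}
    (h : i ≠ j) : Prime (X i - X j : MvPolynomial σ A) := by
  rw [← MulEquiv.prime_iff (shearEquiv A h), shearEquiv_sub]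
  exact X_prime

theorem sub_rename_swap_dvd {σ : Type*} [DecidableEq σ] (A : Type*) [CommRing A] (i j : σ)
    (p : MvPolynomial σ A) : X i - X j ∣ p - rename (Equiv.swap i j) p := by
  rw [← Ideal.mem_span_singleton, ← Ideal.Quotient.mk_eq_mk_iff_sub_mem]
  have hij : Ideal.Quotient.mk (Ideal.span {(X i - X j : MvPolynomial σ A)}) (X i) =
      Ideal.Quotient.mk _ (X j) := by
    rw [Ideal.Quotient.mk_eq_mk_iff_sub_mem]
    exact Ideal.mem_span_singleton_self _
  have : (Ideal.Quotient.mkₐ A (Ideal.span {(X i - X j : MvPolynomial σ A)})) =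
      (Ideal.Quotient.mkₐ A _).comp (rename (Equiv.swap i j)) := by
    ext k
    simp only [AlgHom.comp_apply, rename_X, Ideal.Quotient.mkₐ_eq_mk]
    rcases eq_or_ne k i with rfl | hki
    · rw [Equiv.swap_apply_left, hij]
    rcases eq_or_ne k j with rfl | hkj
    · rw [Equiv.swap_apply_right, hij]
    rw [Equiv.swap_apply_of_ne_of_ne hki hkj]
  exact congrArg (fun f => f p) this

theorem exists_sub_rename_swap_eq_of_mem (A : Type*) [CommRing A] (n : ℕ) (a : Fin n → A)
    (i j : Fin n) {p : MvPolynomial (Fin n) A} (hp : p ∈ splittingIdeal A n a) :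
    ∃ q ∈ splittingIdeal A n a, p - rename (Equiv.swap i j) p = (X i - X j) * q := by
  refine Submodule.span_induction (p := fun p _ => ∃ q ∈ splittingIdeal A n a,
    p - rename (Equiv.swap i j) p = (X i - X j) * q) ?_ ?_ ?_ ?_ hp
  · rintro _ ⟨k, rfl⟩
    refine ⟨0, Ideal.zero_mem _, ?_⟩
    simp only [map_sub, esymm_isSymmetric (Fin n) A (k.1 + 1) (Equiv.swap i j), rename_C]
    simp
  · exact ⟨0, Ideal.zero_mem _, by simp⟩
  · rintro x y _ _ ⟨q, hq, hx⟩ ⟨r, hr, hy⟩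
    refine ⟨q + r, Ideal.add_mem _ hq hr, ?_⟩
    rw [map_add, mul_add, ← hx, ← hy]
    ring
  · rintro r x hxm ⟨q, hq, hx⟩
    obtain ⟨s, hs⟩ := sub_rename_swap_dvd A i j r
    refine ⟨s * x + rename (Equiv.swap i j) r * q,
      Ideal.add_mem _ (Ideal.mul_mem_left _ _ hxm) (Ideal.mul_mem_left _ _ hq), ?_⟩
    rw [smul_eq_mul, map_mul]
    linear_combination x * hs + rename (Equiv.swap i j) r * hx

theorem two_smul_mem_splittingIdeal (A : Type*) [CommRing A] (n : ℕ) (a : Fin n → A)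
    {i j : Fin n} (hij : i ≠ j) {p q : MvPolynomial (Fin n) A}
    (hpq : p - rename (Equiv.swap i j) p = (X i - X j) * q)
    (hq : (X i - X j) * q ∈ splittingIdeal A n a) : 2 * q ∈ splittingIdeal A n a := by
  have hreg := isRegular_X_sub_X A hij
  have hpp : rename (Equiv.swap i j) (rename (Equiv.swap i j) p) = p := by
    rw [rename_rename]
    have : ((Equiv.swap i j : Fin n → Fin n) ∘ (Equiv.swap i j)) = id := by
      ext k; simp
    rw [this, rename_id_apply]
  have hd : rename (Equiv.swap i j) (X i - X j : MvPolynomial (Fin n) A) = X j - X i := by simp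
  have hqs : rename (Equiv.swap i j) q = q := by
    apply hreg
    have := congrArg (rename (Equiv.swap i j)) hpq
    rw [map_sub, hpp, map_mul, hd] at this
    show (X i - X j) * _ = (X i - X j) * _
    linear_combination hpq + this
  obtain ⟨r, hr, h⟩ := exists_sub_rename_swap_eq_of_mem A n a i j hq
  have : 2 * q = r := by
    apply hreg
    rw [map_mul, hd, hqs] at h
    show (X i - X j) * _ = (X i - X j) * _
    linear_combination h
  rwa [this]

/-- The exponents occurring in staircase polynomials in the first `m` variables. -/
def staircaseSet (n m : ℕ) : Set (Fin n →₀ ℕ) :=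
  {s | (∀ i, s i + i.1 < n) ∧ ∀ i : Fin n, m ≤ i.1 → s i = 0}

theorem monomial_sub_rename_swap {n : ℕ} (A : Type*) [CommRing A] {i j : Fin n} (hij : i ≠ j)
    (s : Fin n →₀ ℕ) (hs : s j = 0) :
    (monomial s (1 : A)) - rename (Equiv.swap i j) (monomial s 1) =
      (X i - X j) * ∑ l ∈ Finset.range (s i),
        monomial (s.erase i + (Finsupp.single i l + Finsupp.single j (s i - 1 - l))) 1 := by
  have h1 : monomial s (1 : A) = monomial (s.erase i) 1 * X i ^ s i := by
    rw [X_pow_eq_monomial, monomial_mul, Finsupp.erase_add_single, one_mul]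
  have h2 : rename (Equiv.swap i j) (monomial (s.erase i) (1 : A)) = monomial (s.erase i) 1 := by
    rw [rename_monomial]
    suffices h : (s.erase i).mapDomain (Equiv.swap i j) = s.erase i by rw [h]
    ext k
    rw [Finsupp.mapDomain_equiv_apply, Equiv.symm_swap]
    rcases eq_or_ne k i with rfl | hki
    · simp [Finsupp.erase_ne hij.symm, hs]
    rcases eq_or_ne k j with rfl | hkj
    · simp [Finsupp.erase_ne hij.symm, hs]
    rw [Equiv.swap_apply_of_ne_of_ne hki hkj]
  have h3 : ∀ l, monomial (s.erase i + (Finsupp.single i l + Finsupp.single j (s i - 1 - l)))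
      (1 : A) = monomial (s.erase i) 1 * (X i ^ l * X j ^ (s i - 1 - l)) := fun l => by
    simp [X_pow_eq_monomial, monomial_mul]
  rw [h1, map_mul, h2, Finset.sum_congr rfl fun l _ => h3 l, ← Finset.mul_sum, mul_left_comm,
    mul_comm (X i - X j), (Commute.all (X i) (X j)).geom_sum₂_mul]
  simp [mul_sub]

theorem exists_staircase_quotient {n : ℕ} (A : Type*) [CommRing A] {i j : Fin n}
    (hij : j.1 = i.1 + 1) {p : MvPolynomial (Fin n) A}
    (hp : p ∈ restrictSupport A (staircaseSet n (i.1 + 1))) :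
    ∃ q ∈ restrictSupport A (staircaseSet n n),
      p - rename (Equiv.swap i j) p = (X i - X j) * q := by
  have hne : i ≠ j := fun h => by simp [h] at hij
  rw [restrictSupport_eq_span] at hp
  refine Submodule.span_induction (p := fun p _ => ∃ q ∈ restrictSupport A (staircaseSet n n),
    p - rename (Equiv.swap i j) p = (X i - X j) * q) ?_ ?_ ?_ ?_ hp
  · rintro _ ⟨s, hs, rfl⟩
    refine ⟨_, ?_, monomial_sub_rename_swap A hne s (hs.2 j hij.ge)⟩
    refine Submodule.sum_mem _ fun l hl => ?_
    rw [monomial_mem_restrictSupport]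
    left
    refine ⟨fun k => ?_, fun k hk => absurd k.2 (by omega)⟩
    rw [Finset.mem_range] at hl
    have hsk := hs.1 k
    have hsi := hs.1 i
    rcases eq_or_ne k i with rfl | hki
    · simp [hne]
      omega
    rcases eq_or_ne k j with rfl | hkj
    · have := hs.2 k hij.ge
      simp [hne.symm, this]
      omega
    simpa [Finsupp.erase_ne hki, hki.symm, hkj.symm, Finsupp.single_apply] using hsk
  · exact ⟨0, Submodule.zero_mem _, by simp⟩
  · rintro x y _ _ ⟨q, hq, hx⟩ ⟨r, hr, hy⟩
    refine ⟨q + r, Submodule.add_mem _ hq hr, ?_⟩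
    rw [map_add, mul_add, ← hx, ← hy]
    ring
  · rintro c x _ ⟨q, hq, hx⟩
    refine ⟨c • q, Submodule.smul_mem _ _ hq, ?_⟩
    rw [map_smul, mul_smul_comm, ← hx, smul_sub]

/-- Staircase polynomials map isomorphically onto the splitting algebra. -/
theorem splittingMk_bijOn_staircase (A : Type u) [CommRing A] [Nontrivial A] (n : ℕ)
    (a : Fin n → A) :
    Function.Bijective ((splittingMk A n a).toLinearMap.comp
      (restrictSupport A (staircaseSet n n)).subtype) := by
  let e : staircaseSet n n ≃ Staircase n :=
    Equiv.subtypeEquivRight fun s => ⟨fun h => h.1, fun h => ⟨h, fun i hi => absurd i.2 (by omega)⟩⟩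
  have : (splittingMk A n a).toLinearMap.comp (restrictSupport A (staircaseSet n n)).subtype =
      ((basisRestrictSupport A (staircaseSet n n)).equiv (splittingBasis A n a) e).toLinearMap := by
    refine (basisRestrictSupport A (staircaseSet n n)).ext fun s => ?_
    rw [LinearEquiv.coe_coe, Module.Basis.equiv_apply, splittingBasis_apply]
    have : ((basisRestrictSupport A (staircaseSet n n)) s : MvPolynomial (Fin n) A) =
      monomial s.1 1 := by
      have h : basisRestrictSupport A (staircaseSet n n) s =
          ⟨monomial s.1 1, (monomial_mem_restrictSupport A).2 (Or.inl s.2)⟩ := by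
        rw [Module.Basis.apply_eq_iff]
        ext t
        show coeff t.1 (monomial s.1 (1 : A)) = _
        rw [coeff_monomial, Finsupp.single_apply]
        simp only [Subtype.ext_iff]
      rw [h]
    simp only [LinearMap.comp_apply, Submodule.subtype_apply, this, AlgHom.toLinearMap_apply]
    rw [monomial_eq, map_mul, map_one, map_one, one_mul, Finsupp.prod_fintype _ _ (by simp),
      map_prod]
    simp only [map_pow]
    rfl
  rw [this]
  exact LinearEquiv.bijective _

theorem mem_of_swap_invariant {n : ℕ} {A : Type*} [CommRing A] {i j : Fin n}
    (hij : j.1 = i.1 + 1) {p : MvPolynomial (Fin n) A}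
    (hp : p ∈ restrictSupport A (staircaseSet n (i.1 + 1)))
    (h : rename (Equiv.swap i j) p = p) : p ∈ restrictSupport A (staircaseSet n i.1) := by
  rw [mem_restrictSupport_iff] at hp ⊢
  intro s hs
  refine ⟨(hp hs).1, fun k hk => ?_⟩
  rcases eq_or_ne k i with rfl | hki
  · have hs' : s.mapDomain (Equiv.swap k j) ∈ p.support := by
      rw [mem_support_iff, ← h, coeff_rename_mapDomain _ (Equiv.injective _)]
      simpa using hs
    have := (hp hs').2 j hij.ge
    rwa [Finsupp.mapDomain_equiv_apply, Equiv.symm_swap, Equiv.swap_apply_right] at this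
  · have : k.1 ≠ i.1 := fun h => hki (Fin.ext h)
    exact (hp hs).2 k (by omega)

theorem prod_pairs_add_comp_perm {S : Type*} [CommSemiring S] {n : ℕ} (t : Fin n → S)
    (σ : Equiv.Perm (Fin n)) :
    ∏ p ∈ Finset.univ.filter (fun p : Fin n × Fin n => p.1 < p.2), (t (σ p.1) + t (σ p.2)) =
      ∏ p ∈ Finset.univ.filter (fun p : Fin n × Fin n => p.1 < p.2), (t p.1 + t p.2) := by
  let g : (Fin n → S) → Sym2 (Fin n) → S := fun t =>
    Sym2.lift ⟨fun i j => t i + t j, fun i j => add_comm _ _⟩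
  have key : ∀ t : Fin n → S,
      ∏ p ∈ Finset.univ.filter (fun p : Fin n × Fin n => p.1 < p.2), (t p.1 + t p.2) =
        ∏ z ∈ Finset.univ.filter (fun z : Sym2 (Fin n) => ¬ z.IsDiag), g t z := by
    intro t
    have h := Finset.sum_sym2_filter_not_isDiag (M := Additive S)
      (Finset.univ : Finset (Fin n)) (g t)
    rw [Finset.sym2_univ] at h
    refine Eq.trans ?_ h.symm
    refine Finset.prod_congr ?_ fun _ _ => rfl
    ext p
    simp only [Finset.mem_filter, Finset.mem_univ, Finset.mem_offDiag, true_and]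
    exact ⟨fun h => ⟨h.ne, h⟩, fun h => h.2⟩
  rw [key t, key fun i => t (σ i)]
  refine Finset.prod_bij (fun z _ => z.map σ) ?_ ?_ ?_ ?_
  · intro z
    induction z with | _ i j => simp
  · exact fun z _ w _ h => Sym2.map.injective σ.injective h
  · intro z hz
    refine ⟨z.map σ.symm, ?_, by simp [Sym2.map_map]⟩
    induction z with | _ i j => simpa using hz
  · intro z _
    induction z with | _ i j => rfl

theorem exists_aeval_esymm_eq_prod_pairs (A : Type*) [CommRing A] (n : ℕ) :
    ∃ q : MvPolynomial (Fin n) A, aeval (fun k : Fin n => esymm (Fin n) A (k.1 + 1)) q =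
      ∏ p ∈ Finset.univ.filter (fun p : Fin n × Fin n => p.1 < p.2),
        (X p.1 + X p.2 : MvPolynomial (Fin n) A) := by
  have hsymm : (∏ p ∈ Finset.univ.filter (fun p : Fin n × Fin n => p.1 < p.2),
      (X p.1 + X p.2 : MvPolynomial (Fin n) A)).IsSymmetric := fun σ => by
    simp only [map_prod, map_add, rename_X]
    exact prod_pairs_add_comp_perm X σ
  obtain ⟨q, hq⟩ := (esymmAlgHom_fin_bijective A n).2 ⟨_, hsymm⟩
  refine ⟨q, ?_⟩
  rw [← esymmAlgHom_apply, hq]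

theorem exists_algebraMap_eq_Df (A : Type*) [CommRing A] (n : ℕ) (a : Fin n → A) :
    ∃ d : A, algebraMap A (SplittingAlg A n a) d = Df A n a := by
  obtain ⟨q, hq⟩ := exists_aeval_esymm_eq_prod_pairs A n
  refine ⟨aeval (fun k : Fin n => (-1 : A) ^ (k.1 + 1) * a k) q, ?_⟩
  have h := congrArg (splittingMk A n a) hq
  rw [map_prod] at h
  rw [← aeval_algebraMap_apply, show Df A n a = _ from h.symm, comp_aeval_apply]
  simp only [splittingMk_esymm]
  rfl

theorem mem_range_of_invariant (A : Type u) [CommRing A] [Nontrivial A] (n : ℕ) (a : Fin n → A)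
    (hA : ∀ b : A, 2 * b = 0 → algebraMap A (SplittingAlg A n a) b * Df A n a = 0 → b = 0)
    {x : SplittingAlg A n a} (hx : ∀ σ, permHom A n a σ x = x) :
    x ∈ Set.range (algebraMap A (SplittingAlg A n a)) := by
  obtain ⟨hinj, hsurj⟩ := splittingMk_bijOn_staircase A n a
  obtain ⟨d, hd⟩ := exists_algebraMap_eq_Df A n a
  have hzero : ∀ v : SplittingAlg A n a, 2 * v = 0 → v * Df A n a = 0 → v = 0 := by
    intro v h2 hD
    refine (splittingBasis A n a).ext_elem fun s => ?_
    rw [map_zero, Finsupp.zero_apply]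
    have h2' : (2 : A) • v = 0 := by
      rw [ofNat_smul_eq_nsmul, two_nsmul, ← two_mul, h2]
    have hd' : d • v = 0 := by
      rw [← hD, ← hd, mul_comm]
      exact Algebra.smul_def d v
    have e2 := congrArg (fun z => (splittingBasis A n a).repr z s) h2'
    have ed := congrArg (fun z => (splittingBasis A n a).repr z s) hd'
    simp only [map_smul, Finsupp.smul_apply, smul_eq_mul, map_zero, Finsupp.zero_apply] at e2 ed
    refine hA _ e2 ?_
    rw [← hd, ← map_mul, mul_comm, ed, map_zero]
  obtain ⟨⟨p, hp⟩, rfl⟩ := hsurj x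
  change splittingMk A n a p ∈ _
  change ∀ σ, permHom A n a σ (splittingMk A n a p) = splittingMk A n a p at hx
  have key : ∀ m, m < n → p ∈ restrictSupport A (staircaseSet n (n - 1 - m)) := by
    intro m hm
    induction m with
    | zero =>
      rw [mem_restrictSupport_iff] at hp ⊢
      intro s hs
      refine ⟨(hp hs).1, fun k hk => ?_⟩
      have := (hp hs).1 k
      omega
    | succ m ih =>
      have h1 := ih (by omega)
      let i : Fin n := ⟨n - 1 - (m + 1), by omega⟩
      let j : Fin n := ⟨n - 1 - m, by omega⟩
      have hij : j.1 = i.1 + 1 := by simp only [i, j]; omega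
      have hne : i ≠ j := fun h => by simp [h] at hij
      have h2 : p ∈ restrictSupport A (staircaseSet n (i.1 + 1)) := by rwa [← hij]
      obtain ⟨q, hq, hpq⟩ := exists_staircase_quotient A hij h2
      refine mem_of_swap_invariant hij h2 ?_
      have hker : (X i - X j) * q ∈ splittingIdeal A n a := by
        rw [← splittingMk_eq_zero_iff, ← hpq, map_sub, ← permHom_mk, hx, sub_self]
      have hker2 := two_smul_mem_splittingIdeal A n a hne hpq hker
      have hv2 : 2 * splittingMk A n a q = 0 := by
        rw [← splittingMk_eq_zero_iff, map_mul, map_ofNat] at hker2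
        exact hker2
      have hvd : splittingMk A n a q * (tau A n a i + tau A n a j) = 0 := by
        rw [← splittingMk_eq_zero_iff, map_mul, map_sub] at hker
        change (tau A n a i - tau A n a j) * _ = 0 at hker
        linear_combination hker + tau A n a j * hv2
      have hvD : splittingMk A n a q * Df A n a = 0 := by
        rw [Df, ← Finset.mul_prod_erase _ _ (a := (i, j)) (by
          rw [Finset.mem_filter]
          exact ⟨Finset.mem_univ _, Fin.lt_def.2 (by simp only; omega)⟩), ← mul_assoc, hvd,
          zero_mul]
      have hv := hzero _ hv2 hvD
      have hq0 : q = 0 := by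
        have := @hinj ⟨q, hq⟩ 0 (by rw [map_zero]; exact hv)
        exact congrArg Subtype.val this
      rw [hq0, mul_zero, sub_eq_zero] at hpq
      exact hpq.symm
  have hpC : p = C (coeff 0 p) := by
    have h0 : p ∈ restrictSupport A (staircaseSet n 0) := by
      rcases Nat.eq_zero_or_pos n with rfl | hn
      · exact hp
      · simpa using key (n - 1) (by omega)
    rw [mem_restrictSupport_iff] at h0
    ext s
    rw [coeff_C]
    split_ifs with hs
    · rw [hs]
    · by_contra hne
      exact hs (Finsupp.ext fun k => ((h0 (mem_support_iff.2 hne)).2 k (Nat.zero_le _)).symm)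
  refine ⟨coeff 0 p, ?_⟩
  conv_rhs => rw [hpC]
  rfl

theorem splittingAlg_smul_def {A : Type*} [CommRing A] {n : ℕ} {a : Fin n → A} (c : A)
    (x : SplittingAlg A n a) : c • x = algebraMap A (SplittingAlg A n a) c * x :=
  Algebra.smul_def c x

/-- Base change of splitting algebras along a ring homomorphism. -/
noncomputable def splittingBaseChange {A B : Type*} [CommRing A] [CommRing B] {n : ℕ}
    {a : Fin n → A} {a' : Fin n → B} (φ : A →+* B) (h : ∀ k, φ (a k) = a' k) :
    SplittingAlg A n a →+* SplittingAlg B n a' :=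
  splittingLift n a ((algebraMap B (SplittingAlg B n a')).comp φ) (tau B n a') fun k => by
    rw [esymm_tau, RingHom.comp_apply, map_mul φ, h, map_pow, map_neg, map_one]

section BaseChange

variable {A : Type u} {B : Type v} [CommRing A] [CommRing B] {n : ℕ}
    {a : Fin n → A} {a' : Fin n → B} (φ : A →+* B) (h : ∀ k, φ (a k) = a' k)

theorem splittingBaseChange_tau (i : Fin n) :
    splittingBaseChange φ h (tau A n a i) = tau B n a' i :=
  splittingLift_tau _ _ _ _ _ _

theorem splittingBaseChange_algebraMap (c : A) :
    splittingBaseChange φ h (algebraMap A _ c) = algebraMap B _ (φ c) :=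
  splittingLift_algebraMap _ _ _ _ _ _

theorem splittingBaseChange_Df : splittingBaseChange φ h (Df A n a) = Df B n a' := by
  simp only [Df, map_prod, map_add, splittingBaseChange_tau]

theorem splittingBaseChange_permHom (σ : Equiv.Perm (Fin n)) (x : SplittingAlg A n a) :
    splittingBaseChange φ h (permHom A n a σ x) = permHom B n a' σ (splittingBaseChange φ h x) := by
  have : (splittingBaseChange φ h).comp (permHom A n a σ).toRingHom =
      (permHom B n a' σ).toRingHom.comp (splittingBaseChange φ h) := by
    refine splittingAlg_hom_ext (fun c => ?_) fun i => ?_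
    · show splittingBaseChange φ h (permHom A n a σ (algebraMap A _ c)) =
        permHom B n a' σ (splittingBaseChange φ h (algebraMap A _ c))
      rw [AlgHom.commutes, splittingBaseChange_algebraMap, AlgHom.commutes]
    · show splittingBaseChange φ h (permHom A n a σ (tau A n a i)) =
        permHom B n a' σ (splittingBaseChange φ h (tau A n a i))
      rw [permHom_tau, splittingBaseChange_tau, splittingBaseChange_tau, permHom_tau]
  exact congrArg (fun f : SplittingAlg A n a →+* SplittingAlg B n a' => f x) this

theorem splittingBaseChange_basis [Nontrivial A] [Nontrivial B] (s : Staircase n) :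
    splittingBaseChange φ h (splittingBasis A n a s) = splittingBasis B n a' s := by
  simp only [splittingBasis_apply, map_prod, map_pow, splittingBaseChange_tau]

theorem splittingBaseChange_repr [Nontrivial A] [Nontrivial B] (x : SplittingAlg A n a)
    (s : Staircase n) :
    (splittingBasis B n a').repr (splittingBaseChange φ h x) s =
      φ ((splittingBasis A n a).repr x s) := by
  have key : splittingBaseChange φ h x =
      ∑ t, φ ((splittingBasis A n a).repr x t) • splittingBasis B n a' t := by
    conv_lhs => rw [← (splittingBasis A n a).sum_repr x]
    rw [map_sum]
    refine Finset.sum_congr rfl fun t _ => ?_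
    rw [splittingAlg_smul_def, map_mul, splittingBaseChange_algebraMap, splittingBaseChange_basis,
      splittingAlg_smul_def]
  rw [key, Module.Basis.repr_sum_self]

end BaseChange

/-- McCoy's theorem: if `b ≠ 0` annihilates all maximal minors of a matrix, then its columns are
linearly dependent. -/
theorem exists_mulVec_eq_zero_of_mul_det_eq_zero {A ι κ : Type*} [CommRing A] [Fintype κ]
    [DecidableEq κ] {b : A} (hb : b ≠ 0) (M : Matrix ι κ A)
    (hM : ∀ e : κ → ι, b * (M.submatrix e id).det = 0) :
    ∃ v : κ → A, v ≠ 0 ∧ M.mulVec v = 0 := by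
  have fin_case : ∀ (r : ℕ) (M : Matrix ι (Fin r) A),
      (∀ e : Fin r → ι, b * (M.submatrix e id).det = 0) →
        ∃ v : Fin r → A, v ≠ 0 ∧ M.mulVec v = 0 := by
    intro r
    induction r with
    | zero =>
      intro M hM
      exact absurd (by simpa using hM Fin.elim0) hb
    | succ r ih =>
      intro M hM
      by_cases hex : ∃ e : Fin r → ι, b * (M.submatrix e Fin.succ).det ≠ 0
      · obtain ⟨e, he⟩ := hex
        refine ⟨fun j => b * ((-1) ^ (j : ℕ) * (M.submatrix e j.succAbove).det), ?_, ?_⟩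
        · intro h
          exact he (by simpa using congrFun h 0)
        · ext i
          have h := hM (Fin.cons i e)
          rw [Matrix.det_succ_row_zero, Finset.mul_sum] at h
          rw [Matrix.mulVec, dotProduct, Pi.zero_apply, ← h]
          refine Finset.sum_congr rfl fun j _ => ?_
          have : ((M.submatrix (Fin.cons i e : Fin (r + 1) → ι) id).submatrix Fin.succ
              j.succAbove) = M.submatrix e j.succAbove := by
            ext k l
            simp
          rw [this]
          simp only [Matrix.submatrix_apply, Fin.cons_zero, id]
          ring
      · push Not at hex
        obtain ⟨v, hv, hMv⟩ := ih (M.submatrix id Fin.succ) fun e => hex e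
        refine ⟨Fin.cons 0 v, fun h => hv ?_, ?_⟩
        · ext j
          simpa using congrFun h j.succ
        · ext i
          have := congrFun hMv i
          simpa [Matrix.mulVec, dotProduct, Fin.sum_univ_succ] using this
  let f := Fintype.equivFin κ
  obtain ⟨v, hv, hMv⟩ := fin_case _ (M.submatrix id f.symm) fun e => by
    rw [← hM (e ∘ f), ← Matrix.det_submatrix_equiv_self f.symm]
    congr 2
    ext i j
    simp
  refine ⟨v ∘ f, fun h => hv ?_, ?_⟩
  · ext j
    simpa using congrFun h (f.symm j)
  · rw [← hMv]
    ext i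
    simp only [Matrix.mulVec, dotProduct, Matrix.submatrix_apply, id, Function.comp]
    exact (Equiv.sum_comp f fun j => M i (f.symm j) * v j).symm ▸ (by simp)

/-- The sum of the monomials `∏ i, t (w i) ^ i` over the even permutations `w`. -/
def evenSum {S : Type*} [CommRing S] {n : ℕ} (t : Fin n → S) : S :=
  ∑ w ∈ Finset.univ.filter (fun w : Equiv.Perm (Fin n) => w.sign = 1), ∏ i, t (w i) ^ i.1

theorem evenSum_comp_perm {S : Type*} [CommRing S] {n : ℕ} (t : Fin n → S)
    (σ : Equiv.Perm (Fin n)) :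
    evenSum (fun i => t (σ i)) =
      ∑ w ∈ Finset.univ.filter (fun w : Equiv.Perm (Fin n) => w.sign = σ.sign),
        ∏ i, t (w i) ^ i.1 := by
  refine Finset.sum_equiv (Equiv.mulLeft σ) ?_ ?_
  · intro w
    simp
  · intro w _
    rfl

theorem evenSum_comp_perm_sub {S : Type*} [CommRing S] [CharP S 2] {n : ℕ} (t : Fin n → S)
    (σ : Equiv.Perm (Fin n)) :
    evenSum (fun i => t (σ i)) - evenSum t =
      if σ.sign = 1 then 0 else
        ∏ p ∈ Finset.univ.filter (fun p : Fin n × Fin n => p.1 < p.2), (t p.1 + t p.2) := by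
  rw [evenSum_comp_perm]
  split_ifs with hσ
  · rw [hσ]
    exact sub_self _
  · have hσ' : σ.sign = -1 := (Int.units_eq_one_or _).resolve_left hσ
    rw [CharTwo.sub_eq_add, evenSum, hσ', add_comm]
    have hfilter : Finset.univ.filter (fun w : Equiv.Perm (Fin n) => w.sign = -1) =
        Finset.univ.filter (fun w : Equiv.Perm (Fin n) => ¬ w.sign = 1) := by
      ext w
      rcases Int.units_eq_one_or w.sign with h | h <;> simp [h]
    rw [hfilter, Finset.sum_filter_add_sum_filter_not]
    have hdet := Matrix.det_vandermonde t
    rw [Matrix.det_apply'] at hdet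
    have hs : ∀ w : Equiv.Perm (Fin n), ((w.sign : ℤ) : S) = 1 := fun w => by
      rcases Int.units_eq_one_or w.sign with h | h <;> simp [h, CharTwo.neg_eq]
    simp only [hs, one_mul, Matrix.vandermonde_apply] at hdet
    rw [hdet, Finset.prod_sigma']
    refine Finset.prod_bij' (fun p _ => (p.1, p.2)) (fun p _ => ⟨p.1, p.2⟩) ?_ ?_ ?_ ?_ ?_
    · simp
    · simp
    · simp
    · simp
    · intro p _
      rw [CharTwo.sub_eq_add, add_comm]

theorem not_X_sub_X_dvd {σ A : Type*} [CommRing A] [Nontrivial A] {i j k l : σ}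
    (hkl : k ≠ l) (h : ¬ (k = i ∧ l = j)) (h' : ¬ (k = j ∧ l = i)) :
    ¬ (X i - X j : MvPolynomial σ A) ∣ X k - X l := by
  classical
  rintro ⟨q, hq⟩
  have h01 : (0 : A) ≠ 1 := zero_ne_one
  have key : ∀ t : σ → A, t i = t j → t k = t l := fun t ht => by
    have := congrArg (eval t) hq
    simpa [ht, sub_eq_zero] using this
  by_cases hk : k = i ∨ k = j
  · have := key (fun m => if m = l then 1 else 0)
    grind
  · have := key (fun m => if m = k then 1 else 0)
    grind

theorem prod_X_add_X_dvd {K : Type*} [Field K] [CharP K 2] {n : ℕ} {p : MvPolynomial (Fin n) K}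
    (h : ∀ i j : Fin n, i < j → X i - X j ∣ p) :
    ∏ z ∈ Finset.univ.filter (fun z : Fin n × Fin n => z.1 < z.2),
      (X z.1 + X z.2 : MvPolynomial (Fin n) K) ∣ p := by
  simp only [← CharTwo.sub_eq_add]
  refine Finset.prod_dvd_of_isRelPrime ?_ ?_
  · rintro ⟨i, j⟩ hij ⟨k, l⟩ hkl hne
    simp only [Finset.coe_filter, Finset.mem_univ, true_and, Set.mem_ofPred_eq] at hij hkl
    show IsRelPrime (X i - X j) (X k - X l)
    refine ((prime_X_sub_X K hij.ne).irreducible.isRelPrime_iff_not_dvd).2 ?_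
    refine not_X_sub_X_dvd hkl.ne (fun hh => hne ?_) fun hh => ?_
    · rw [hh.1, hh.2]
    · rw [hh.1, hh.2] at hkl
      exact absurd hkl hij.not_gt
  · intro z hz
    exact h _ _ (Finset.mem_filter.1 hz).2

/-- The matrix of the linear system expressing invariance under all permutations, on the span of
the nonconstant elements of the monomial basis. -/
noncomputable def invariantMatrix (A : Type u) [CommRing A] [Nontrivial A] (n : ℕ)
    (a : Fin n → A) :
    Matrix (Equiv.Perm (Fin n) × Staircase n) {s : Staircase n // s ≠ Staircase.zero n} A :=
  Matrix.of fun k s => (splittingBasis A n a).repr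
    (permHom A n a k.1 (splittingBasis A n a s) - splittingBasis A n a s) k.2

theorem invariantMatrix_map {A : Type u} {B : Type v} [CommRing A] [CommRing B] [Nontrivial A]
    [Nontrivial B] {n : ℕ} {a : Fin n → A} {a' : Fin n → B} (φ : A →+* B)
    (h : ∀ k, φ (a k) = a' k) :
    (invariantMatrix A n a).map φ = invariantMatrix B n a' := by
  ext k s
  simp only [invariantMatrix, Matrix.map_apply, Matrix.of_apply]
  rw [← splittingBaseChange_repr φ h, map_sub, splittingBaseChange_permHom,
    splittingBaseChange_basis]

theorem sum_staircase_eq {M : Type*} [AddCommMonoid M] {n : ℕ} (f : Staircase n → M) :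
    ∑ s, f s = f (Staircase.zero n) + ∑ s : {s : Staircase n // s ≠ Staircase.zero n}, f s := by
  classical
  exact Fintype.sum_eq_add_sum_subtype_ne f (Staircase.zero n)

theorem invariantMatrix_mulVec {A : Type u} [CommRing A] [Nontrivial A] {n : ℕ} {a : Fin n → A}
    (v : Staircase n → A) (k : Equiv.Perm (Fin n) × Staircase n) :
    (invariantMatrix A n a).mulVec (fun s => v s) k = (splittingBasis A n a).repr
      (permHom A n a k.1 (∑ s, v s • splittingBasis A n a s) -
        ∑ s, v s • splittingBasis A n a s) k.2 := by
  have h : permHom A n a k.1 (∑ s, v s • splittingBasis A n a s) -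
      ∑ s, v s • splittingBasis A n a s =
      ∑ s, v s • (permHom A n a k.1 (splittingBasis A n a s) - splittingBasis A n a s) := by
    simp only [map_sum, map_smul, smul_sub, Finset.sum_sub_distrib]
  rw [h, sum_staircase_eq, splittingBasis_zero, map_one, sub_self, smul_zero, zero_add, map_sum,
    Finsupp.finsetSum_apply]
  refine Finset.sum_congr rfl fun s _ => ?_
  rw [map_smul, Finsupp.smul_apply, smul_eq_mul, mul_comm]
  rfl

/-- The comparison map from the universal splitting algebra in characteristic two to the
polynomial ring in the roots. -/
noncomputable def universalToPoly (n : ℕ) :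
    SplittingAlg (MvPolynomial (Fin n) (ZMod 2)) n X →+* MvPolynomial (Fin n) (ZMod 2) :=
  splittingLift n X (aeval fun k : Fin n => esymm (Fin n) (ZMod 2) (k.1 + 1)).toRingHom X
    fun k => by
      have h := aeval_esymm_eq_multiset_esymm (Fin n) (ZMod 2) (k.1 + 1)
        (X : Fin n → MvPolynomial (Fin n) (ZMod 2))
      rw [← h, aeval_X_left]
      simp [CharTwo.neg_eq]

theorem universalToPoly_tau (n : ℕ) (i : Fin n) :
    universalToPoly n (tau _ n X i) = X i :=
  splittingLift_tau _ _ _ _ _ _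

theorem universalToPoly_algebraMap (n : ℕ) (c : MvPolynomial (Fin n) (ZMod 2)) :
    universalToPoly n (algebraMap _ _ c) =
      aeval (fun k : Fin n => esymm (Fin n) (ZMod 2) (k.1 + 1)) c :=
  splittingLift_algebraMap _ _ _ _ _ _

theorem rename_aeval_esymm {n : ℕ} {R : Type*} [CommRing R] (σ : Equiv.Perm (Fin n))
    (c : MvPolynomial (Fin n) R) :
    rename σ (aeval (fun k : Fin n => esymm (Fin n) R (k.1 + 1)) c) =
      aeval (fun k : Fin n => esymm (Fin n) R (k.1 + 1)) c := by
  rw [← esymmAlgHom_apply]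
  exact (esymmAlgHom (Fin n) R n c).2 σ

theorem universalToPoly_permHom (n : ℕ) (σ : Equiv.Perm (Fin n))
    (x : SplittingAlg (MvPolynomial (Fin n) (ZMod 2)) n X) :
    universalToPoly n (permHom _ n X σ x) = rename σ (universalToPoly n x) := by
  have : (universalToPoly n).comp (permHom _ n X σ).toRingHom =
      (rename σ).toRingHom.comp (universalToPoly n) := by
    refine splittingAlg_hom_ext (fun c => ?_) fun i => ?_
    · show universalToPoly n (permHom _ n X σ (algebraMap _ _ c)) =
        rename σ (universalToPoly n (algebraMap _ _ c))
      rw [AlgHom.commutes, universalToPoly_algebraMap, rename_aeval_esymm]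
    · show universalToPoly n (permHom _ n X σ (tau _ n X i)) =
        rename σ (universalToPoly n (tau _ n X i))
      rw [permHom_tau, universalToPoly_tau, universalToPoly_tau, rename_X]
  exact congrArg (fun f : SplittingAlg (MvPolynomial (Fin n) (ZMod 2)) n X →+*
    MvPolynomial (Fin n) (ZMod 2) => f x) this

/-- The polynomial `∏ i < j, (X i + X j)` in characteristic two. -/
noncomputable def pairPoly (n : ℕ) : MvPolynomial (Fin n) (ZMod 2) :=
  ∏ z ∈ Finset.univ.filter (fun z : Fin n × Fin n => z.1 < z.2), (X z.1 + X z.2)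

theorem pairPoly_ne_zero (n : ℕ) : pairPoly n ≠ 0 := by
  refine Finset.prod_ne_zero_iff.2 fun z hz => ?_
  rw [← CharTwo.sub_eq_add]
  exact (prime_X_sub_X (ZMod 2) (Finset.mem_filter.1 hz).2.ne).ne_zero

theorem rename_pairPoly (n : ℕ) (σ : Equiv.Perm (Fin n)) :
    rename σ (pairPoly n) = pairPoly n := by
  simp only [pairPoly, map_prod, map_add, rename_X]
  exact prod_pairs_add_comp_perm X σ

theorem universalToPoly_Df (n : ℕ) : universalToPoly n (Df _ n X) = pairPoly n := by
  simp only [Df, pairPoly, map_prod, map_add, universalToPoly_tau]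

theorem aeval_esymm_injective (n : ℕ) (R : Type*) [CommRing R] : Function.Injective
    (aeval (R := R) (fun k : Fin n => esymm (Fin n) R (k.1 + 1))) := by
  intro p q h
  refine esymmAlgHom_fin_injective R le_rfl (Subtype.ext ?_)
  rw [esymmAlgHom_apply, esymmAlgHom_apply, h]

theorem dvd_of_sub_dvd {n : ℕ} {d c : MvPolynomial (Fin n) (ZMod 2)}
    (hd : aeval (fun k : Fin n => esymm (Fin n) (ZMod 2) (k.1 + 1)) d = pairPoly n)
    (h : ∀ i j : Fin n, i < j →
      X i - X j ∣ aeval (fun k : Fin n => esymm (Fin n) (ZMod 2) (k.1 + 1)) c) : d ∣ c := by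
  obtain ⟨q, hq⟩ := prod_X_add_X_dvd h
  change _ = pairPoly n * q at hq
  have hsymm : q.IsSymmetric := fun σ => by
    have := congrArg (rename σ) hq
    rw [map_mul, rename_aeval_esymm, rename_pairPoly, hq] at this
    exact (mul_left_cancel₀ (pairPoly_ne_zero n) this).symm
  obtain ⟨r, hr⟩ := (esymmAlgHom_fin_bijective (ZMod 2) n).2 ⟨q, hsymm⟩
  refine ⟨r, aeval_esymm_injective n (ZMod 2) ?_⟩
  rw [map_mul, hd, hq, ← esymmAlgHom_apply, hr]

theorem permHom_evenSum_sub {A : Type u} [CommRing A] [CharP A 2] [Nontrivial A] {n : ℕ}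
    {a : Fin n → A} (σ : Equiv.Perm (Fin n)) :
    permHom A n a σ (evenSum (tau A n a)) - evenSum (tau A n a) =
      if σ.sign = 1 then 0 else Df A n a := by
  have : CharP (SplittingAlg A n a) 2 :=
    charP_of_injective_algebraMap (algebraMap_injective_splittingAlg A n a) 2
  have h : permHom A n a σ (evenSum (tau A n a)) = evenSum fun i => tau A n a (σ i) := by
    simp only [evenSum, map_sum, map_prod, map_pow, permHom_tau]
  rw [h]
  exact evenSum_comp_perm_sub _ σ

theorem exists_det_smul_evenSum {A : Type u} [CommRing A] [CharP A 2] [Nontrivial A] {n : ℕ}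
    {a : Fin n → A} {d : A} (hd : algebraMap A (SplittingAlg A n a) d = Df A n a)
    (e : {s : Staircase n // s ≠ Staircase.zero n} → Equiv.Perm (Fin n) × Staircase n)
    [DecidableEq {s : Staircase n // s ≠ Staircase.zero n}] :
    ∃ (r : A) (h : SplittingAlg A n a),
      ((invariantMatrix A n a).submatrix e id).det • evenSum (tau A n a) =
        algebraMap A (SplittingAlg A n a) r + d • h := by
  let N := (invariantMatrix A n a).submatrix e id
  let bas := splittingBasis A n a
  let p := bas.repr (evenSum (tau A n a))
  have hNp : ∃ w, N.mulVec (fun s => p s) = d • w := by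
    have : ∀ k, ∃ y, N.mulVec (fun s => p s) k = d * y := by
      intro k
      have h := invariantMatrix_mulVec (a := a) p (e k)
      rw [Module.Basis.sum_repr, permHom_evenSum_sub] at h
      change N.mulVec _ k = _ at h
      split_ifs at h with hs
      · exact ⟨0, by rw [h]; simp⟩
      · refine ⟨bas.repr 1 (e k).2, h.trans ?_⟩
        rw [← hd, Algebra.algebraMap_eq_smul_one, map_smul]
        rfl
    choose w hw using this
    exact ⟨w, funext hw⟩
  obtain ⟨w, hw⟩ := hNp
  have hcp : ∀ s : {s : Staircase n // s ≠ Staircase.zero n},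
      N.det * p s = d * N.adjugate.mulVec w s := by
    intro s
    have h := congrArg (N.adjugate.mulVec) hw
    rw [Matrix.mulVec_mulVec, Matrix.adjugate_mul, Matrix.smul_mulVec, Matrix.one_mulVec,
      Matrix.mulVec_smul] at h
    exact congrFun h s
  refine ⟨N.det * p (Staircase.zero n),
    ∑ s : {s : Staircase n // s ≠ Staircase.zero n}, N.adjugate.mulVec w s • bas s, ?_⟩
  change N.det • _ = _
  conv_lhs => rw [← bas.sum_repr (evenSum (tau A n a)), Finset.smul_sum, sum_staircase_eq]
  rw [show bas (Staircase.zero n) = 1 from splittingBasis_zero _ _ _, smul_smul,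
    ← Algebra.algebraMap_eq_smul_one, Finset.smul_sum]
  congr 1
  refine Finset.sum_congr rfl fun s _ => ?_
  rw [smul_smul, smul_smul, ← hcp]

theorem exists_det_smul_Df {A : Type u} [CommRing A] [CharP A 2] [Nontrivial A] {n : ℕ}
    {a : Fin n → A} {d : A} (hd : algebraMap A (SplittingAlg A n a) d = Df A n a)
    (e : {s : Staircase n // s ≠ Staircase.zero n} → Equiv.Perm (Fin n) × Staircase n)
    [DecidableEq {s : Staircase n // s ≠ Staircase.zero n}] :
    ∃ h : SplittingAlg A n a, ∀ i j : Fin n, i ≠ j →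
      ((invariantMatrix A n a).submatrix e id).det • Df A n a =
        d • (permHom A n a (Equiv.swap i j) h - h) := by
  obtain ⟨r, h, hr⟩ := exists_det_smul_evenSum hd e
  refine ⟨h, fun i j hij => ?_⟩
  have hP := permHom_evenSum_sub (a := a) (Equiv.swap i j)
  rw [Equiv.Perm.sign_swap hij, if_neg (by decide)] at hP
  have h1 := congrArg (permHom A n a (Equiv.swap i j)) hr
  rw [map_smul, map_add, AlgHom.commutes, map_smul] at h1
  rw [← hP, smul_sub, h1, hr, smul_sub]
  abel

theorem dvd_det_invariantMatrix {n : ℕ} {d : MvPolynomial (Fin n) (ZMod 2)}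
    (hd : algebraMap _ (SplittingAlg (MvPolynomial (Fin n) (ZMod 2)) n X) d = Df _ n X)
    (e : {s : Staircase n // s ≠ Staircase.zero n} → Equiv.Perm (Fin n) × Staircase n)
    [DecidableEq {s : Staircase n // s ≠ Staircase.zero n}] :
    d ∣ ((invariantMatrix (MvPolynomial (Fin n) (ZMod 2)) n X).submatrix e id).det := by
  have hdpoly : aeval (fun k : Fin n => esymm (Fin n) (ZMod 2) (k.1 + 1)) d = pairPoly n := by
    rw [← universalToPoly_algebraMap, hd, universalToPoly_Df]
  obtain ⟨h, hh⟩ := exists_det_smul_Df hd e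
  generalize ((invariantMatrix (MvPolynomial (Fin n) (ZMod 2)) n X).submatrix e id).det = c at hh ⊢
  refine dvd_of_sub_dvd hdpoly fun i j hij => ?_
  have h3 := congrArg (universalToPoly n) (hh i j hij.ne)
  rw [splittingAlg_smul_def, splittingAlg_smul_def, map_mul, map_mul, map_sub,
    universalToPoly_algebraMap, universalToPoly_algebraMap, universalToPoly_Df, hdpoly,
    universalToPoly_permHom, mul_comm] at h3
  rw [mul_left_cancel₀ (pairPoly_ne_zero n) h3, dvd_sub_comm]
  exact sub_rename_swap_dvd _ _ _ _

theorem eq_zero_of_invariants_eq_bot {A : Type u} [CommRing A] {n : ℕ} {a : Fin n → A}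
    (hA : ∀ x : SplittingAlg A n a, (∀ σ, permHom A n a σ x = x) →
      x ∈ Set.range (algebraMap A (SplittingAlg A n a)))
    {b : A} (hb2 : 2 * b = 0) (hbD : algebraMap A (SplittingAlg A n a) b * Df A n a = 0) :
    b = 0 := by
  classical
  by_contra hb
  have : Nontrivial A := ⟨b, 0, hb⟩
  have hmem : ∀ c, c ∈ Ideal.torsionOf A A b ↔ b * c = 0 := fun c => by
    rw [Ideal.mem_torsionOf_iff, smul_eq_mul, mul_comm]
  let B := A ⧸ Ideal.torsionOf A A b
  have : Nontrivial B := Ideal.Quotient.nontrivial_iff.2 fun h => hb <| by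
    have : (1 : A) ∈ Ideal.torsionOf A A b := h ▸ Submodule.mem_top
    simpa using (hmem 1).1 this
  let ψ : A →+* B := Ideal.Quotient.mk _
  have hψ : ∀ c, ψ c = 0 ↔ b * c = 0 := fun c => Ideal.Quotient.eq_zero_iff_mem.trans (hmem c)
  have : CharP B 2 := CharTwo.of_one_ne_zero_of_two_eq_zero one_ne_zero <| by
    rw [← map_ofNat ψ, hψ, mul_comm, hb2]
  let φ : MvPolynomial (Fin n) (ZMod 2) →+* B :=
    eval₂Hom (ZMod.castHom (dvd_refl 2) B) fun k => ψ (a k)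
  have hφ : ∀ k, φ (X k) = ψ (a k) := fun k => by simp [φ]
  obtain ⟨d, hd⟩ := exists_algebraMap_eq_Df (MvPolynomial (Fin n) (ZMod 2)) n X
  obtain ⟨d', hd'⟩ := exists_algebraMap_eq_Df A n a
  have hbd : b * d' = 0 := by
    apply algebraMap_injective_splittingAlg A n a
    rw [map_mul, hd', hbD, map_zero]
  have hdd : φ d = ψ d' := by
    apply algebraMap_injective_splittingAlg B n fun k => ψ (a k)
    rw [← splittingBaseChange_algebraMap φ hφ, hd, splittingBaseChange_Df,
      ← splittingBaseChange_algebraMap ψ (fun _ => rfl), hd', splittingBaseChange_Df]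
  have hminor : ∀ e, b * ((invariantMatrix A n a).submatrix e id).det = 0 := by
    intro e
    obtain ⟨q, hq⟩ := dvd_det_invariantMatrix hd e
    rw [← hψ, RingHom.map_det, RingHom.mapMatrix_apply, ← Matrix.submatrix_map,
      invariantMatrix_map ψ (fun _ => rfl), ← invariantMatrix_map φ hφ, Matrix.submatrix_map,
      ← RingHom.mapMatrix_apply, ← RingHom.map_det, hq, map_mul, hdd, (hψ _).2 hbd, zero_mul]
  obtain ⟨v, hv, hMv⟩ := exists_mulVec_eq_zero_of_mul_det_eq_zero hb _ hminor
  let v' : Staircase n → A := fun s => if hs : s ≠ Staircase.zero n then v ⟨s, hs⟩ else 0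
  have hv' : (fun s : {s : Staircase n // s ≠ Staircase.zero n} => v' s) = v :=
    funext fun s => dif_pos s.2
  obtain ⟨c, hc⟩ := hA (∑ s, v' s • splittingBasis A n a s) fun σ => by
    refine (splittingBasis A n a).ext_elem fun s => ?_
    have h := invariantMatrix_mulVec (a := a) v' (σ, s)
    rw [hv', hMv, map_sub, Finsupp.sub_apply] at h
    exact sub_eq_zero.1 h.symm
  apply hv
  ext s
  have h := congrArg (fun x => (splittingBasis A n a).repr x s) hc
  simp only [Module.Basis.repr_sum_self] at h
  rw [Algebra.algebraMap_eq_smul_one, ← splittingBasis_zero, map_smul, Module.Basis.repr_self,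
    Finsupp.smul_apply, Finsupp.single_eq_of_ne s.2, smul_zero] at h
  rw [← hv', Pi.zero_apply]
  exact h.symm

/-- The set of `S_n`-invariant elements of the splitting algebra `A_f` equals the
image of `algebraMap A A_f` if and only if every `a ∈ A` with `2·a = 0` and
`(algebraMap A A_f a)·D_f = 0` equals `0`. -/
theorem invariants_eq_bot_iff (A : Type*) [CommRing A] (n : ℕ) (hn : 1 ≤ n) (a : Fin n → A) :
    {x : SplittingAlg A n a | ∀ σ : Equiv.Perm (Fin n), permHom A n a σ x = x}
      = Set.range (algebraMap A (SplittingAlg A n a)) ↔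
    ∀ b : A, 2 * b = 0 → algebraMap A (SplittingAlg A n a) b * Df A n a = 0 → b = 0 := by
  constructor
  · intro h b hb2 hbD
    exact eq_zero_of_invariants_eq_bot (fun x hx => h ▸ hx) hb2 hbD
  · intro h
    ext x
    constructor
    · intro hx
      rcases subsingleton_or_nontrivial A with hA | hA
      · have : Subsingleton (SplittingAlg A n a) := Module.subsingleton A _
        exact ⟨0, Subsingleton.elim _ _⟩
      · exact mem_range_of_invariant A n a h hx
    · rintro ⟨c, rfl⟩ σ
      exact AlgHom.commutes _ c
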